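/- Let F(A,θ) be the free partially commutative group and (B,Z) a partition of A. The natural group morphism α: F(β_Z^R(B̃), θ̃_{β_Z^R(B̃)}) → H_Z (sending the generator zw to w⁻¹zw) is injective if and only if B is a transitively factorizing subalphabet of A (i.e. for every (z,z') ∈ Z²∩θ there is no path in the dependence graph from z to z' with all inner vertices in B). -/

import Mathlib

namespace PCM

variable {A : Type*}

/-- Elementary commutation relation on words. -/
def TraceRel (θ : A → A → Prop) : FreeMonoid A → FreeMonoid A → Prop :=
  fun x y => ∃ a b, θ a b ∧ x = FreeMonoid.of a * FreeMonoid.of b ∧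
    y = FreeMonoid.of b * FreeMonoid.of a

/-- The congruence generated by the commutations. -/
def traceCon (θ : A → A → Prop) : Con (FreeMonoid A) := conGen (TraceRel θ)

/-- The free partially commutative (trace) monoid `M(A,θ)`. -/
abbrev Trace (A : Type*) (θ : A → A → Prop) := (traceCon θ).Quotient

/-- Canonical projection from words to traces. -/
def trMk (θ : A → A → Prop) : FreeMonoid A →* Trace A θ := (traceCon θ).mk'

/-- The trace of a single letter. -/
def trOf (θ : A → A → Prop) (a : A) : Trace A θ := trMk θ (FreeMonoid.of a)

/-- `IA t` : the set of possible initial letters of a trace. -/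
def IA (θ : A → A → Prop) (t : Trace A θ) : Set A := {a | ∃ w, t = trOf θ a * w}

/-- The alphabet of a trace. -/
def Alph (θ : A → A → Prop) (t : Trace A θ) : Set A :=
  {a | ∃ l : List A, trMk θ (FreeMonoid.ofList l) = t ∧ a ∈ l}

/-- The submonoid `M(B,θ_B)` generated by a subalphabet. -/
def subTr (θ : A → A → Prop) (B : Set A) : Submonoid (Trace A θ) :=
  Submonoid.closure (trOf θ '' B)

/-- `β_Z(B)` where `Z = A - B`. -/
def beta (θ : A → A → Prop) (B : Set A) : Set (Trace A θ) :=
  {t | ∃ z, z ∉ B ∧ ∃ w ∈ subTr θ B, t = trOf θ z * w ∧ IA θ t = {z}}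

/-- The induced independence relation `θ_X` on a set of traces. -/
def thetaX (θ : A → A → Prop) (X : Set (Trace A θ)) (x y : X) : Prop :=
  ∀ a ∈ Alph θ (x : Trace A θ), ∀ b ∈ Alph θ (y : Trace A θ), θ a b

/-- `X` is a partially commutative code : the canonical morphism from
`M(X,θ_X)` is injective. -/
def IsPCCode (θ : A → A → Prop) (X : Set (Trace A θ)) : Prop :=
  ∃ f : Trace X (thetaX θ X) →* Trace A θ,
    (∀ x : X, f (trOf (thetaX θ X) x) = (x : Trace A θ)) ∧ Function.Injective f

/-- Dependence relation (edges of the dependence graph). -/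
def dep (θ : A → A → Prop) (a b : A) : Prop := a ≠ b ∧ ¬ θ a b

/-- A path `z - b₁ - ⋯ - bₙ - z'` in the dependence graph with inner vertices in `B`. -/
def DepPathB (θ : A → A → Prop) (B : Set A) (z z' : A) : Prop :=
  ∃ l : List A, (∀ b ∈ l, b ∈ B) ∧ List.Chain (dep θ) z (l ++ [z'])

/-- `B` is a transitively factorizing subalphabet. -/
def IsTFSA (θ : A → A → Prop) (B : Set A) : Prop :=
  ∀ z z', z ∉ B → z' ∉ B → θ z z' → ¬ DepPathB θ B z z'

end PCM

namespace PCM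

variable {A : Type*}

/-- Forget the bar of a signed letter of `Ã = A ∪ Ā`. -/
def unbar : A ⊕ A → A := Sum.elim id id

/-- The independence relation `θ̃` on `Ã = A ∪ Ā`. -/
def tilde (θ : A → A → Prop) : (A ⊕ A) → (A ⊕ A) → Prop :=
  fun x y => θ (unbar x) (unbar y)

/-- Commutation relators for the free partially commutative group. -/
def pcRels (θ : A → A → Prop) : Set (FreeGroup A) :=
  {w | ∃ a b, θ a b ∧
    w = FreeGroup.of a * FreeGroup.of b * (FreeGroup.of a)⁻¹ * (FreeGroup.of b)⁻¹}

/-- The free partially commutative group `F(A,θ)`. -/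
abbrev PCGroup (A : Type*) (θ : A → A → Prop) := PresentedGroup (pcRels θ)

/-- The generator of `F(A,θ)` corresponding to a letter. -/
def gOf (θ : A → A → Prop) (a : A) : PCGroup A θ := PresentedGroup.of a

/-- A trace has length `n`. -/
def HasLen (θ : A → A → Prop) (t : Trace A θ) (n : ℕ) : Prop :=
  ∃ l : List A, trMk θ (FreeMonoid.ofList l) = t ∧ l.length = n

/-- `s` is the canonical morphism `M(Ã,θ̃) → F(A,θ)`. -/
def IsSection (θ : A → A → Prop)
    (s : Trace (A ⊕ A) (tilde θ) →* PCGroup A θ) : Prop :=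
  (∀ a : A, s (trOf (tilde θ) (Sum.inl a)) = gOf θ a) ∧
  (∀ a : A, s (trOf (tilde θ) (Sum.inr a)) = (gOf θ a)⁻¹)

/-- A trace over `Ã` is reduced: it has minimal length in its fiber under `s`. -/
def ReducedWrt (θ : A → A → Prop)
    (s : Trace (A ⊕ A) (tilde θ) →* PCGroup A θ)
    (t : Trace (A ⊕ A) (tilde θ)) : Prop :=
  ∀ (t' : Trace (A ⊕ A) (tilde θ)) (n n' : ℕ),
    s t' = s t → HasLen (tilde θ) t n → HasLen (tilde θ) t' n' → n ≤ n'

/-- `ρ_Z(B) = {w⁻¹zw | zw ∈ β_Z^R(B̃)}` inside `F(A,θ)`. -/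
def rhoSet (θ : A → A → Prop) (B : Set A)
    (s : Trace (A ⊕ A) (tilde θ) →* PCGroup A θ) : Set (PCGroup A θ) :=
  {g | ∃ z, z ∉ B ∧ ∃ wl : List (A ⊕ A), (∀ x ∈ wl, unbar x ∈ B) ∧
    IA (tilde θ) (trMk (tilde θ) (FreeMonoid.ofList (Sum.inl z :: wl))) = {Sum.inl z} ∧
    ReducedWrt θ s (trMk (tilde θ) (FreeMonoid.ofList (Sum.inl z :: wl))) ∧
    g = (s (trMk (tilde θ) (FreeMonoid.ofList wl)))⁻¹ * gOf θ z *
        s (trMk (tilde θ) (FreeMonoid.ofList wl))}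

/-- The set `β_Z^R(B̃)` of reduced traces `zw`. -/
def betaR (θ : A → A → Prop) (B : Set A)
    (s : Trace (A ⊕ A) (tilde θ) →* PCGroup A θ) : Set (Trace (A ⊕ A) (tilde θ)) :=
  {t | ∃ z, z ∉ B ∧ ∃ wl : List (A ⊕ A), (∀ x ∈ wl, unbar x ∈ B) ∧
    t = trMk (tilde θ) (FreeMonoid.ofList (Sum.inl z :: wl)) ∧
    IA (tilde θ) t = {Sum.inl z} ∧ ReducedWrt θ s t}

end PCM

namespace PCM

section TraceTheory

variable {C : Type*} {ϑ : C → C → Prop}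

/-- Trace of a word. -/
def tl (ϑ : C → C → Prop) (l : List C) : Trace C ϑ := trMk ϑ (FreeMonoid.ofList l)

theorem tl_surj (t : Trace C ϑ) : ∃ l, tl ϑ l = t := by
  obtain ⟨w, rfl⟩ := Con.mk'_surjective t
  exact ⟨FreeMonoid.toList w, rfl⟩

theorem tl_append (l l' : List C) : tl ϑ (l ++ l') = tl ϑ l * tl ϑ l' := by
  simp [tl, FreeMonoid.ofList_append]

theorem tl_nil : tl ϑ [] = 1 := by simp [tl]

theorem tl_single (c : C) : tl ϑ [c] = trOf ϑ c := rfl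

theorem tl_cons (c : C) (l : List C) : tl ϑ (c :: l) = trOf ϑ c * tl ϑ l := by
  rw [← tl_single, ← tl_append]; rfl

theorem trOf_comm {a b : C} (h : ϑ a b) : trOf ϑ a * trOf ϑ b = trOf ϑ b * trOf ϑ a := by
  have : traceCon ϑ (FreeMonoid.of a * FreeMonoid.of b) (FreeMonoid.of b * FreeMonoid.of a) :=
    ConGen.Rel.of _ _ ⟨a, b, h, rfl, rfl⟩
  have h2 := (Con.eq (traceCon ϑ)).2 this
  simpa [trOf, trMk] using h2

theorem tl_inv {β : Type*} (f : List C → β)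
    (hf : ∀ u a b v, ϑ a b → f (u ++ a :: b :: v) = f (u ++ b :: a :: v))
    {l l' : List C} (h : tl ϑ l = tl ϑ l') : f l = f l' := by
  let c : Con (FreeMonoid C) :=
    { r := fun x y => ∀ u v, f (u ++ FreeMonoid.toList x ++ v) = f (u ++ FreeMonoid.toList y ++ v)
      iseqv := ⟨fun x u v => rfl, fun h u v => (h u v).symm, fun h h' u v => (h u v).trans (h' u v)⟩
      mul' := by
        intro w x y z h1 h2 u v
        have e1 := h1 u (FreeMonoid.toList y ++ v)
        have e2 := h2 (u ++ FreeMonoid.toList x) v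
        simp only [FreeMonoid.toList_mul, List.append_assoc] at *
        exact e1.trans e2 }
  have hle : traceCon ϑ ≤ c := by
    refine Con.conGen_le.2 ?_
    rintro x y ⟨a, b, hab, rfl, rfl⟩ u v
    simpa using hf u a b v hab
  have := hle ((Con.eq (traceCon ϑ)).1 h) [] []
  simpa using this

theorem tl_perm {l l' : List C} (h : tl ϑ l = tl ϑ l') : l.Perm l' := by
  have := tl_inv (ϑ := ϑ) (fun l => (l : Multiset C)) (by
    intro u a b v _
    exact Multiset.coe_eq_coe.2 ((List.Perm.swap b a v).append_left u)) h
  exact Multiset.coe_eq_coe.1 this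

theorem mem_Alph_tl (l : List C) (c : C) : c ∈ Alph ϑ (tl ϑ l) ↔ c ∈ l := by
  constructor
  · rintro ⟨l', h, hc⟩
    exact (tl_perm (ϑ := ϑ) h).mem_iff.1 hc
  · intro h
    exact ⟨l, rfl, h⟩

theorem mem_Alph_mul (t u : Trace C ϑ) (c : C) :
    c ∈ Alph ϑ (t * u) ↔ c ∈ Alph ϑ t ∨ c ∈ Alph ϑ u := by
  obtain ⟨l, rfl⟩ := tl_surj t
  obtain ⟨l', rfl⟩ := tl_surj u
  rw [← tl_append]; simp [mem_Alph_tl]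

theorem mem_Alph_trOf (c d : C) : c ∈ Alph ϑ (trOf ϑ d) ↔ c = d := by
  rw [← tl_single]; simp [mem_Alph_tl]

/-- Initial letters of a word. -/
def Init (ϑ : C → C → Prop) (c : C) : List C → Prop
  | [] => False
  | y :: l => c = y ∨ (ϑ c y ∧ Init ϑ c l)

theorem Init_swap (hs : ∀ a b, ϑ a b → ϑ b a) (c : C) (u : List C) (a b : C) (v : List C)
    (h : ϑ a b) : Init ϑ c (u ++ a :: b :: v) = Init ϑ c (u ++ b :: a :: v) := by
  induction u with
  | nil =>
    have := hs _ _ h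
    simp only [List.nil_append, Init, eq_iff_iff]
    constructor
    · rintro (rfl | ⟨h1, rfl | ⟨h2, h3⟩⟩) <;> tauto
    · rintro (rfl | ⟨h1, rfl | ⟨h2, h3⟩⟩) <;> tauto
  | cons y u ih => simp only [List.cons_append, Init, ih]

theorem Init_split {c : C} {l : List C} (h : Init ϑ c l) : ∃ l', tl ϑ l = tl ϑ (c :: l') := by
  induction l with
  | nil => exact h.elim
  | cons y l ih =>
    rcases h with rfl | ⟨h1, h2⟩
    · exact ⟨l, rfl⟩
    · obtain ⟨l', e⟩ := ih h2
      refine ⟨y :: l', ?_⟩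
      rw [tl_cons, e, tl_cons, tl_cons, tl_cons, ← mul_assoc, ← mul_assoc, trOf_comm h1]

theorem Init_of_eq (hs : ∀ a b, ϑ a b → ϑ b a) {c : C} {l : List C} {t : Trace C ϑ}
    (h : tl ϑ l = trOf ϑ c * t) : Init ϑ c l := by
  obtain ⟨l', rfl⟩ := tl_surj t
  rw [← tl_cons] at h
  have := tl_inv (ϑ := ϑ) (Init ϑ c) (Init_swap hs c) h
  rw [this]
  exact Or.inl rfl

theorem mem_IA_tl (hs : ∀ a b, ϑ a b → ϑ b a) {c : C} {l : List C} :
    c ∈ IA ϑ (tl ϑ l) ↔ Init ϑ c l := by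
  constructor
  · rintro ⟨w, h⟩
    exact Init_of_eq hs h
  · intro h
    obtain ⟨l', e⟩ := Init_split h
    exact ⟨tl ϑ l', by rw [e, tl_cons]⟩

theorem left_cancel (hi : ∀ a, ¬ ϑ a a) {x : C} {t t' : Trace C ϑ}
    (h : trOf ϑ x * t = trOf ϑ x * t') : t = t' := by
  classical
  obtain ⟨l, rfl⟩ := tl_surj t
  obtain ⟨l', rfl⟩ := tl_surj t'
  rw [← tl_cons, ← tl_cons] at h
  have := tl_inv (ϑ := ϑ) (fun l => tl ϑ (l.erase x)) (by
    intro u a b v hab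
    have hne : a ≠ b := fun e => hi b (e ▸ hab)
    simp only [List.erase_append]
    split_ifs with hu
    · simp only [tl_append, tl_cons]
      rw [← mul_assoc (trOf ϑ a), ← mul_assoc (trOf ϑ b), trOf_comm hab]
    · by_cases ha : a = x
      · subst ha
        rw [List.erase_cons_head, List.erase_cons_tail (by simpa using hne.symm),
          List.erase_cons_head]
      · by_cases hb : b = x
        · subst hb
          rw [List.erase_cons_head, List.erase_cons_tail (by simpa using hne),
            List.erase_cons_head]
        · rw [List.erase_cons_tail (by simpa using ha), List.erase_cons_tail (by simpa using hb),
            List.erase_cons_tail (by simpa using hb), List.erase_cons_tail (by simpa using ha)]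
          simp only [tl_append, tl_cons]
          rw [← mul_assoc (trOf ϑ a), ← mul_assoc (trOf ϑ b), trOf_comm hab]) h
  simpa using this

theorem left_levi (hi : ∀ a, ¬ ϑ a a) (hs : ∀ a b, ϑ a b → ϑ b a) {x y : C} {t t' : Trace C ϑ}
    (h : trOf ϑ x * t = trOf ϑ y * t') (hne : x ≠ y) :
    ϑ x y ∧ ∃ t0, t = trOf ϑ y * t0 ∧ t' = trOf ϑ x * t0 := by
  obtain ⟨l', rfl⟩ := tl_surj t'
  have h1 : Init ϑ x (y :: l') := Init_of_eq hs (t := t) (by rw [tl_cons, h])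
  rcases h1 with h1 | ⟨h1, h2⟩
  · exact (hne h1).elim
  obtain ⟨l0, e⟩ := Init_split h2
  refine ⟨h1, tl ϑ l0, ?_, by rw [e, tl_cons]⟩
  apply left_cancel hi (x := x)
  rw [h, e, tl_cons, ← mul_assoc, ← mul_assoc, trOf_comm h1]

/-- Reversal. -/
noncomputable def rev (ϑ : C → C → Prop) (t : Trace C ϑ) : Trace C ϑ :=
  tl ϑ (Classical.choose (tl_surj t)).reverse

theorem rev_tl (hs : ∀ a b, ϑ a b → ϑ b a) (l : List C) : rev ϑ (tl ϑ l) = tl ϑ l.reverse := by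
  have h := Classical.choose_spec (tl_surj (tl ϑ l))
  refine tl_inv (ϑ := ϑ) (fun l => tl ϑ l.reverse) ?_ h
  intro u a b v hab
  simp only [List.reverse_append, List.reverse_cons, tl_append, tl_single, mul_assoc]
  rw [← mul_assoc (trOf ϑ a), ← mul_assoc (trOf ϑ b), trOf_comm hab]

theorem rev_mul (hs : ∀ a b, ϑ a b → ϑ b a) (t t' : Trace C ϑ) :
    rev ϑ (t * t') = rev ϑ t' * rev ϑ t := by
  obtain ⟨l, rfl⟩ := tl_surj t
  obtain ⟨l', rfl⟩ := tl_surj t'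
  rw [← tl_append, rev_tl hs, rev_tl hs, rev_tl hs, List.reverse_append, tl_append]

theorem rev_rev (hs : ∀ a b, ϑ a b → ϑ b a) (t : Trace C ϑ) : rev ϑ (rev ϑ t) = t := by
  obtain ⟨l, rfl⟩ := tl_surj t
  rw [rev_tl hs, rev_tl hs, List.reverse_reverse]

theorem rev_trOf (hs : ∀ a b, ϑ a b → ϑ b a) (c : C) : rev ϑ (trOf ϑ c) = trOf ϑ c := by
  rw [← tl_single, rev_tl hs]; rfl

theorem right_cancel (hi : ∀ a, ¬ ϑ a a) (hs : ∀ a b, ϑ a b → ϑ b a) {x : C} {t t' : Trace C ϑ}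
    (h : t * trOf ϑ x = t' * trOf ϑ x) : t = t' := by
  have h := congrArg (rev ϑ) h
  rw [rev_mul hs, rev_mul hs, rev_trOf hs] at h
  have := congrArg (rev ϑ) (left_cancel hi h)
  rwa [rev_rev hs, rev_rev hs] at this

theorem right_levi (hi : ∀ a, ¬ ϑ a a) (hs : ∀ a b, ϑ a b → ϑ b a) {x y : C} {t t' : Trace C ϑ}
    (h : t * trOf ϑ x = t' * trOf ϑ y) (hne : x ≠ y) :
    ϑ x y ∧ ∃ t0, t = t0 * trOf ϑ y ∧ t' = t0 * trOf ϑ x := by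
  have h := congrArg (rev ϑ) h
  rw [rev_mul hs, rev_mul hs, rev_trOf hs, rev_trOf hs] at h
  obtain ⟨h1, t0, e1, e2⟩ := left_levi hi hs h hne
  refine ⟨h1, rev ϑ t0, ?_, ?_⟩
  · rw [← rev_rev hs t, e1, rev_mul hs, rev_trOf hs]
  · rw [← rev_rev hs t', e2, rev_mul hs, rev_trOf hs]

/-- The letter `x` commutes with all the letters of `t`. -/
def Cm (ϑ : C → C → Prop) (x : C) (t : Trace C ϑ) : Prop := ∀ c ∈ Alph ϑ t, ϑ x c

theorem Cm_mul {x : C} {t u : Trace C ϑ} : Cm ϑ x (t * u) ↔ Cm ϑ x t ∧ Cm ϑ x u := by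
  simp only [Cm, mem_Alph_mul]
  constructor
  · intro h; exact ⟨fun c hc => h c (Or.inl hc), fun c hc => h c (Or.inr hc)⟩
  · rintro ⟨h1, h2⟩ c (hc | hc)
    exacts [h1 c hc, h2 c hc]

theorem Cm_trOf {x c : C} : Cm ϑ x (trOf ϑ c) ↔ ϑ x c := by
  simp [Cm, mem_Alph_trOf]

theorem Cm_comm {x : C} {t : Trace C ϑ} (h : Cm ϑ x t) : t * trOf ϑ x = trOf ϑ x * t := by
  obtain ⟨l, rfl⟩ := tl_surj t
  induction l with
  | nil => simp [tl_nil]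
  | cons y l ih =>
    rw [tl_cons, Cm_mul, Cm_trOf] at h
    rw [tl_cons, mul_assoc, ih h.2, ← mul_assoc, ← mul_assoc, trOf_comm h.1]

theorem Init_append_single {c x : C} {l : List C} (h : Init ϑ c (l ++ [x])) :
    Init ϑ c l ∨ (c = x ∧ ∀ d ∈ l, ϑ c d) := by
  induction l with
  | nil =>
    rcases h with h | h
    · exact Or.inr ⟨h, by simp⟩
    · exact h.2.elim
  | cons y l ih =>
    rcases h with h | ⟨h1, h2⟩
    · exact Or.inl (Or.inl h)
    · rcases ih h2 with h3 | ⟨h3, h4⟩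
      · exact Or.inl (Or.inr ⟨h1, h3⟩)
      · refine Or.inr ⟨h3, ?_⟩
        simpa using ⟨h1, h4⟩

theorem mixed_levi (hs : ∀ a b, ϑ a b → ϑ b a) {c x : C} {t u : Trace C ϑ}
    (h : trOf ϑ c * u = t * trOf ϑ x) : (∃ t', t = trOf ϑ c * t') ∨ (c = x ∧ Cm ϑ x t) := by
  obtain ⟨l, rfl⟩ := tl_surj t
  have h1 : Init ϑ c (l ++ [x]) := Init_of_eq hs (t := u) (by rw [tl_append, tl_single, h])
  rcases Init_append_single h1 with h2 | ⟨rfl, h2⟩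
  · obtain ⟨l', e⟩ := Init_split h2
    exact Or.inl ⟨tl ϑ l', by rw [e, tl_cons]⟩
  · refine Or.inr ⟨rfl, fun d hd => h2 d ?_⟩
    rwa [mem_Alph_tl] at hd

theorem IA_mul_sub (t u : Trace C ϑ) : IA ϑ t ⊆ IA ϑ (t * u) := by
  rintro c ⟨w, rfl⟩
  exact ⟨w * u, by rw [mul_assoc]⟩

theorem IA_mul_trOf (hs : ∀ a b, ϑ a b → ϑ b a) {x : C} {t : Trace C ϑ} (h : ¬ Cm ϑ x t) :
    IA ϑ (t * trOf ϑ x) = IA ϑ t := by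
  apply Set.Subset.antisymm _ (IA_mul_sub _ _)
  rintro c ⟨w, e⟩
  rcases mixed_levi hs e.symm with h1 | ⟨_, h1⟩
  · exact h1
  · exact (h h1).elim

theorem IA_sub_Alph (t : Trace C ϑ) : IA ϑ t ⊆ Alph ϑ t := by
  rintro c ⟨w, rfl⟩
  rw [mem_Alph_mul, mem_Alph_trOf]; exact Or.inl rfl

theorem IA_trOf (hs : ∀ a b, ϑ a b → ϑ b a) (c : C) : IA ϑ (trOf ϑ c) = {c} := by
  ext d
  rw [← tl_single, mem_IA_tl hs]
  simp [Init]

end TraceTheory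

end PCM
namespace PCM

section Action

variable {A : Type*} {θ : A → A → Prop}

theorem unbar_swap (x : A ⊕ A) : unbar x.swap = unbar x := by
  cases x <;> rfl

theorem tilde_irr (hi : ∀ a, ¬ θ a a) (a : A ⊕ A) : ¬ tilde θ a a := hi _

theorem tilde_symm (hs : ∀ a b, θ a b → θ b a) (a b : A ⊕ A) (h : tilde θ a b) : tilde θ b a :=
  hs _ _ h

theorem Cm_swap {x : A ⊕ A} {t : Trace (A ⊕ A) (tilde θ)} :
    Cm (tilde θ) x.swap t ↔ Cm (tilde θ) x t := by
  simp only [Cm, tilde, unbar_swap]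

/-- Combinatorially irreducible traces. -/
def Irr (θ : A → A → Prop) (t : Trace (A ⊕ A) (tilde θ)) : Prop :=
  ∀ p x q, t ≠ p * trOf (tilde θ) x * trOf (tilde θ) x.swap * q

theorem Irr_left {t u : Trace (A ⊕ A) (tilde θ)} (h : Irr θ (t * u)) : Irr θ t := by
  rintro p x q rfl
  exact h p x (q * u) (by simp only [mul_assoc])

theorem Irr_append (hi : ∀ a, ¬ θ a a) (hs : ∀ a b, θ a b → θ b a) {x : A ⊕ A}
    {t : Trace (A ⊕ A) (tilde θ)} (ht : Irr θ t)
    (hx : ¬ ∃ t', t = t' * trOf (tilde θ) x.swap) : Irr θ (t * trOf (tilde θ) x) := by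
  have hi' := tilde_irr hi
  have hs' := tilde_symm hs
  intro p y q
  obtain ⟨l, rfl⟩ := tl_surj q
  induction l using List.reverseRecOn generalizing t with
  | nil =>
    intro h
    rw [tl_nil, mul_one] at h
    by_cases hxy : x = y.swap
    · subst hxy
      have := right_cancel hi' hs' h
      exact hx ⟨p, by rw [Sum.swap_swap]; exact this⟩
    · obtain ⟨h1, t0, e1, e2⟩ := right_levi hi' hs' h hxy
      by_cases hxy' : x = y
      · subst hxy'
        exact hi (unbar x) (by simpa only [tilde, unbar_swap] using h1)
      · obtain ⟨h2, t1, e3, e4⟩ := right_levi hi' hs' e2 (Ne.symm hxy')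
        exact ht t1 y 1 (by rw [e1, e4, mul_one])
  | append_singleton l c ih =>
    intro h
    rw [tl_append, tl_single, ← mul_assoc] at h
    by_cases hxc : x = c
    · subst hxc
      exact ht p y _ (right_cancel hi' hs' h)
    · obtain ⟨h1, t0, e1, e2⟩ := right_levi hi' hs' h hxc
      refine ih (t := t0) (Irr_left (u := trOf (tilde θ) c) (e1 ▸ ht)) ?_ e2.symm
      rintro ⟨t1, rfl⟩
      apply hx
      refine ⟨t1 * trOf (tilde θ) c, ?_⟩
      rw [e1, mul_assoc, mul_assoc, trOf_comm (a := x.swap) (b := c)]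
      simpa only [tilde, unbar_swap] using h1

/-- The index set. -/
def XS (θ : A → A → Prop) (B : Set A) : Set (Trace (A ⊕ A) (tilde θ)) :=
  {t | ∃ z, z ∉ B ∧ ∃ u, (∀ c ∈ Alph (tilde θ) u, unbar c ∈ B) ∧
    t = trOf (tilde θ) (Sum.inl z) * u ∧ IA (tilde θ) t = {Sum.inl z} ∧ Irr θ t}

open Classical in
/-- Right action of a letter. -/
noncomputable def act (θ : A → A → Prop) (x : A ⊕ A) (t : Trace (A ⊕ A) (tilde θ)) :
    Trace (A ⊕ A) (tilde θ) :=
  if h : ∃ t', t = t' * trOf (tilde θ) x.swap then Classical.choose h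
  else if Cm (tilde θ) x t then t else t * trOf (tilde θ) x

theorem act_strip (hi : ∀ a, ¬ θ a a) (hs : ∀ a b, θ a b → θ b a) (x : A ⊕ A)
    (t : Trace (A ⊕ A) (tilde θ)) : act θ x (t * trOf (tilde θ) x.swap) = t := by
  have h : ∃ t', t * trOf (tilde θ) x.swap = t' * trOf (tilde θ) x.swap := ⟨t, rfl⟩
  rw [act, dif_pos h]
  exact (right_cancel (tilde_irr hi) (tilde_symm hs) (Classical.choose_spec h)).symm

theorem act_strip' (hi : ∀ a, ¬ θ a a) (hs : ∀ a b, θ a b → θ b a) (x : A ⊕ A)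
    (t : Trace (A ⊕ A) (tilde θ)) : act θ x.swap (t * trOf (tilde θ) x) = t := by
  have := act_strip hi hs x.swap t
  rwa [Sum.swap_swap] at this

theorem not_end_of_Cm (hi : ∀ a, ¬ θ a a) {x : A ⊕ A}
    {t : Trace (A ⊕ A) (tilde θ)} (h : Cm (tilde θ) x t) :
    ¬ ∃ t', t = t' * trOf (tilde θ) x.swap := by
  rintro ⟨t', rfl⟩
  rw [Cm_mul, Cm_trOf] at h
  exact hi (unbar x) (by simpa only [tilde, unbar_swap] using h.2)

theorem act_cm (hi : ∀ a, ¬ θ a a) {x : A ⊕ A}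
    {t : Trace (A ⊕ A) (tilde θ)} (h : Cm (tilde θ) x t) : act θ x t = t := by
  rw [act, dif_neg (not_end_of_Cm hi h), if_pos h]

theorem act_app {x : A ⊕ A} {t : Trace (A ⊕ A) (tilde θ)}
    (h : ¬ ∃ t', t = t' * trOf (tilde θ) x.swap) (h' : ¬ Cm (tilde θ) x t) :
    act θ x t = t * trOf (tilde θ) x := by
  rw [act, dif_neg h, if_neg h']

variable {B : Set A}

/-- Facts about an element of the index set ending in a letter of `B`. -/
theorem XS_strip (hi : ∀ a, ¬ θ a a) (hs : ∀ a b, θ a b → θ b a) {x : A ⊕ A} (hx : unbar x ∈ B)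
    {t : Trace (A ⊕ A) (tilde θ)} (h : t * trOf (tilde θ) x ∈ XS θ B) :
    t ∈ XS θ B ∧ ¬ Cm (tilde θ) x t ∧ (¬ ∃ t', t = t' * trOf (tilde θ) x.swap) ∧
      IA (tilde θ) t = IA (tilde θ) (t * trOf (tilde θ) x) := by
  have hi' := tilde_irr hi
  have hs' := tilde_symm hs
  obtain ⟨z, hz, u, hu, e, hIA, hirr⟩ := h
  have hzx : Sum.inl z ≠ x := by rintro rfl; exact hz hx
  have hcm : ¬ Cm (tilde θ) x t := by
    intro hc
    have : x ∈ IA (tilde θ) (t * trOf (tilde θ) x) := ⟨t, Cm_comm hc⟩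
    rw [hIA] at this
    exact hzx this.symm
  have hIA2 := IA_mul_trOf hs' hcm
  refine ⟨?_, hcm, ?_, hIA2.symm⟩
  · rcases mixed_levi hs' e.symm with ⟨t', rfl⟩ | ⟨h1, _⟩
    · rw [mul_assoc] at e
      have e2 := left_cancel hi' e
      refine ⟨z, hz, t', ?_, rfl, hIA2 ▸ hIA, Irr_left hirr⟩
      intro c hc
      apply hu
      rw [← e2, mem_Alph_mul]; exact Or.inl hc
    · exact (hzx h1).elim
  · rintro ⟨t', rfl⟩
    exact hirr t' x.swap 1 (by rw [Sum.swap_swap, mul_one])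

theorem XS_app (hi : ∀ a, ¬ θ a a) (hs : ∀ a b, θ a b → θ b a) {x : A ⊕ A} (hx : unbar x ∈ B)
    {t : Trace (A ⊕ A) (tilde θ)} (ht : t ∈ XS θ B)
    (h : ¬ ∃ t', t = t' * trOf (tilde θ) x.swap) (h' : ¬ Cm (tilde θ) x t) :
    t * trOf (tilde θ) x ∈ XS θ B := by
  obtain ⟨z, hz, u, hu, e, hIA, hirr⟩ := ht
  refine ⟨z, hz, u * trOf (tilde θ) x, ?_, by rw [e, mul_assoc], ?_, Irr_append hi hs hirr h⟩
  · intro c hc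
    rw [mem_Alph_mul, mem_Alph_trOf] at hc
    rcases hc with hc | rfl
    · exact hu c hc
    · exact hx
  · rw [IA_mul_trOf (tilde_symm hs) h', hIA]

theorem act_spec (hi : ∀ a, ¬ θ a a) (hs : ∀ a b, θ a b → θ b a) {x : A ⊕ A} (hx : unbar x ∈ B)
    {t : Trace (A ⊕ A) (tilde θ)} (ht : t ∈ XS θ B) :
    act θ x t ∈ XS θ B ∧ IA (tilde θ) (act θ x t) = IA (tilde θ) t ∧
      act θ x.swap (act θ x t) = t := by
  by_cases h : ∃ t', t = t' * trOf (tilde θ) x.swap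
  · obtain ⟨t', rfl⟩ := h
    rw [act_strip hi hs]
    obtain ⟨h1, h2, h3, h4⟩ := XS_strip hi hs (x := x.swap) (by rwa [unbar_swap]) ht
    exact ⟨h1, h4, act_app h3 h2⟩
  · by_cases h' : Cm (tilde θ) x t
    · rw [act_cm hi h', act_cm hi (Cm_swap.2 h')]
      exact ⟨ht, rfl, rfl⟩
    · rw [act_app h h', act_strip' hi hs]
      exact ⟨XS_app hi hs hx ht h h', IA_mul_trOf (tilde_symm hs) h', rfl⟩

theorem end_mul (hi : ∀ a, ¬ θ a a) (hs : ∀ a b, θ a b → θ b a) {x y : A ⊕ A}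
    (hxy : tilde θ x y) {t : Trace (A ⊕ A) (tilde θ)} :
    (∃ t', t * trOf (tilde θ) x = t' * trOf (tilde θ) y) ↔ ∃ t', t = t' * trOf (tilde θ) y := by
  constructor
  · rintro ⟨t', e⟩
    have hne : x ≠ y := by rintro rfl; exact hi _ hxy
    obtain ⟨_, t0, e1, _⟩ := right_levi (tilde_irr hi) (tilde_symm hs) e hne
    exact ⟨t0, e1⟩
  · rintro ⟨t', rfl⟩
    exact ⟨t' * trOf (tilde θ) x, by rw [mul_assoc, mul_assoc, trOf_comm hxy]⟩

theorem Cm_mul_of {x y : A ⊕ A} (hxy : tilde θ x y) {t : Trace (A ⊕ A) (tilde θ)} :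
    Cm (tilde θ) x (t * trOf (tilde θ) y) ↔ Cm (tilde θ) x t := by
  rw [Cm_mul, Cm_trOf]; exact and_iff_left hxy

theorem act_mul (hi : ∀ a, ¬ θ a a) (hs : ∀ a b, θ a b → θ b a) {x y : A ⊕ A}
    (hxy : tilde θ x y) (t : Trace (A ⊕ A) (tilde θ)) (hcm : ¬ Cm (tilde θ) x t) :
    act θ x (t * trOf (tilde θ) y) = act θ x t * trOf (tilde θ) y := by
  have hyx : tilde θ y x.swap := by
    have := tilde_symm hs _ _ hxy
    simpa only [tilde, unbar_swap] using this
  by_cases h : ∃ t', t = t' * trOf (tilde θ) x.swap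
  · obtain ⟨t', rfl⟩ := h
    rw [act_strip hi hs, mul_assoc, ← trOf_comm hyx, ← mul_assoc, act_strip hi hs]
  · rw [act_app h hcm, act_app (by rwa [end_mul hi hs hyx]) (by rwa [Cm_mul_of hxy]), mul_assoc,
      mul_assoc, trOf_comm hxy]

theorem act_mul' (hi : ∀ a, ¬ θ a a) (hs : ∀ a b, θ a b → θ b a) {x y : A ⊕ A}
    (hxy : tilde θ x y) (t : Trace (A ⊕ A) (tilde θ)) :
    act θ x (t * trOf (tilde θ) y) = act θ x t * trOf (tilde θ) y := by
  by_cases hcm : Cm (tilde θ) x t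
  · rw [act_cm hi hcm, act_cm hi ((Cm_mul_of hxy).2 hcm)]
  · exact act_mul hi hs hxy t hcm

theorem act_comm (hi : ∀ a, ¬ θ a a) (hs : ∀ a b, θ a b → θ b a) {x y : A ⊕ A}
    (hxy : tilde θ x y) (t : Trace (A ⊕ A) (tilde θ)) :
    act θ x (act θ y t) = act θ y (act θ x t) := by
  have hyx := tilde_symm hs _ _ hxy
  have hxy' : tilde θ x y.swap := by simpa only [tilde, unbar_swap] using hxy
  have hyx' : tilde θ y x.swap := by simpa only [tilde, unbar_swap] using hyx
  by_cases h : ∃ t', t = t' * trOf (tilde θ) y.swap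
  · obtain ⟨t', rfl⟩ := h
    rw [act_strip hi hs, act_mul' hi hs hxy', act_strip hi hs]
  · by_cases k : ∃ t', t = t' * trOf (tilde θ) x.swap
    · obtain ⟨t', rfl⟩ := k
      rw [act_strip hi hs, act_mul' hi hs hyx', act_strip hi hs]
    · by_cases h' : Cm (tilde θ) y t
      · rw [act_cm hi h']
        by_cases k' : Cm (tilde θ) x t
        · rw [act_cm hi k', act_cm hi h']
        · rw [act_app k k', act_cm hi ((Cm_mul_of hyx).2 h')]
      · rw [act_app h h', act_mul' hi hs hxy]
        by_cases k' : Cm (tilde θ) x t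
        · rw [act_cm hi k', act_app h h']
        · rw [act_app k k', act_mul' hi hs hyx, act_app h h', mul_assoc, mul_assoc, trOf_comm hxy]

theorem XS_trOf (hs : ∀ a b, θ a b → θ b a) {z : A} (hz : z ∉ B) :
    trOf (tilde θ) (Sum.inl z) ∈ XS θ B := by
  refine ⟨z, hz, 1, ?_, by rw [mul_one], IA_trOf (tilde_symm hs) _, ?_⟩
  · intro c hc
    rw [← tl_nil, mem_Alph_tl] at hc
    simp at hc
  · intro p x q h
    obtain ⟨l, rfl⟩ := tl_surj p
    obtain ⟨l', rfl⟩ := tl_surj q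
    rw [← tl_single, ← tl_single, ← tl_single, ← tl_append, ← tl_append, ← tl_append] at h
    have := (tl_perm h).length_eq
    simp at this
    omega

end Action

end PCM
namespace PCM

section Groups

variable {I : Type*} {R : I → I → Prop}

theorem gOf_comm {a b : I} (h : R a b) : gOf R a * gOf R b = gOf R b * gOf R a := by
  have : (PresentedGroup.mk (pcRels R)
      (FreeGroup.of a * FreeGroup.of b * (FreeGroup.of a)⁻¹ * (FreeGroup.of b)⁻¹)) = 1 :=
    PresentedGroup.one_of_mem ⟨a, b, h, rfl⟩
  simp only [map_mul, map_inv] at this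
  have h2 : gOf R a * gOf R b * (gOf R a)⁻¹ * (gOf R b)⁻¹ = 1 := this
  rwa [mul_inv_eq_one, mul_inv_eq_iff_eq_mul] at h2

/-- Universal property. -/
def pcLift {G : Type*} [Group G] (f : I → G) (h : ∀ a b, R a b → f a * f b = f b * f a) :
    PCGroup I R →* G :=
  PresentedGroup.toGroup (f := f) (by
    rintro r ⟨a, b, hab, rfl⟩
    simp only [map_mul, map_inv, FreeGroup.lift_apply_of]
    rw [mul_inv_eq_one, mul_inv_eq_iff_eq_mul]
    exact h a b hab)

theorem pcLift_of {G : Type*} [Group G] (f : I → G) (h : ∀ a b, R a b → f a * f b = f b * f a)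
    (a : I) : pcLift f h (gOf R a) = f a := PresentedGroup.toGroup.of _

theorem pc_ext {G : Type*} [Group G] {f g : PCGroup I R →* G}
    (h : ∀ a, f (gOf R a) = g (gOf R a)) : f = g := PresentedGroup.ext h

/-- Automorphism induced by a permutation of generators. -/
def pcAut (e : Equiv.Perm I) (h1 : ∀ a b, R a b → R (e a) (e b))
    (h2 : ∀ a b, R a b → R (e.symm a) (e.symm b)) : MulAut (PCGroup I R) :=
  MonoidHom.toMulEquiv
    (pcLift (fun a => gOf R (e a)) (fun a b h => gOf_comm (h1 a b h)))
    (pcLift (fun a => gOf R (e.symm a)) (fun a b h => gOf_comm (h2 a b h)))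
    (pc_ext fun a => by simp [pcLift_of])
    (pc_ext fun a => by simp [pcLift_of])

theorem pcAut_of (e : Equiv.Perm I) (h1 : ∀ a b, R a b → R (e a) (e b))
    (h2 : ∀ a b, R a b → R (e.symm a) (e.symm b)) (a : I) :
    pcAut e h1 h2 (gOf R a) = gOf R (e a) := by
  change pcLift (fun a => gOf R (e a)) (fun a b h => gOf_comm (h1 a b h)) (gOf R a) = _
  rw [pcLift_of]

theorem mulAut_ext {f g : MulAut (PCGroup I R)}
    (h : ∀ a, f (gOf R a) = g (gOf R a)) : f = g := by
  have := pc_ext (f := f.toMonoidHom) (g := g.toMonoidHom) h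
  ext x
  exact DFunLike.congr_fun this x

theorem not_comm_of {x y : I} (hxy : x ≠ y) (h1 : ¬ R x y) (h2 : ¬ R y x) :
    gOf R x * gOf R y ≠ gOf R y * gOf R x := by
  classical
  let g : Equiv.Perm (Fin 3) := Equiv.swap 0 1
  let k : Equiv.Perm (Fin 3) := Equiv.swap 1 2
  intro h
  let f : I → Equiv.Perm (Fin 3) := fun i => if i = x then g else if i = y then k else 1
  have hf : ∀ a b, R a b → f a * f b = f b * f a := by
    intro a b hab
    simp only [f]
    split_ifs <;> first | rfl | simp | (subst_vars; contradiction)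
  have := congrArg (pcLift f hf) h
  simp only [map_mul, pcLift_of] at this
  simp only [f, if_true, if_neg hxy.symm] at this
  revert this
  decide

end Groups

section Paths

variable {A : Type*} {θ : A → A → Prop} {B : Set A}

/-- Path from `z` to `c` with inner vertices in `B`. -/
def Pth (θ : A → A → Prop) (B : Set A) (z c : A) : Prop :=
  ∃ l : List A, (∀ b ∈ l, b ∈ B) ∧ List.IsChain (dep θ) (z :: (l ++ [c]))

theorem Pth_iff {z c : A} : DepPathB θ B z c ↔ Pth θ B z c := Iff.rfl

theorem Pth_step {z c d : A} (h : Pth θ B z c) (hc : c ∈ B) (hcd : dep θ c d) : Pth θ B z d := by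
  obtain ⟨l, hl, hch⟩ := h
  refine ⟨l ++ [c], ?_, ?_⟩
  · intro b hb
    simp only [List.mem_append, List.mem_singleton] at hb
    rcases hb with hb | rfl
    exacts [hl b hb, hc]
  · have : z :: ((l ++ [c]) ++ [d]) = (z :: (l ++ [c])) ++ [d] := by simp
    rw [this, List.isChain_append]
    refine ⟨hch, List.isChain_singleton _, ?_⟩
    intro x hx y hy
    simp at hx hy
    subst hy
    rw [← List.cons_append, List.getLast?_append] at hx
    simp at hx
    subst hx
    exact hcd

theorem Pth_single {z c : A} (h : dep θ z c) : Pth θ B z c :=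
  ⟨[], by simp, by simpa using h⟩

theorem dep_symm (hs : ∀ a b, θ a b → θ b a) {a b : A} (h : dep θ a b) : dep θ b a :=
  ⟨h.1.symm, fun h' => h.2 (hs _ _ h')⟩

theorem Pth_symm (hs : ∀ a b, θ a b → θ b a) {z c : A} (h : Pth θ B z c) : Pth θ B c z := by
  obtain ⟨l, hl, hch⟩ := h
  refine ⟨l.reverse, by simpa using hl, ?_⟩
  have := List.isChain_reverse.2 (hch.imp (S := flip (dep θ)) fun a b h => dep_symm hs h)
  simpa [flip] using this

theorem Pth_trans {z c d : A} (h : Pth θ B z c) (hc : c ∈ B) (h' : Pth θ B c d) : Pth θ B z d := by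
  obtain ⟨l, hl, hch⟩ := h'
  induction l generalizing c with
  | nil => exact Pth_step h hc (by simpa using hch)
  | cons b l ih =>
    rw [List.cons_append, List.isChain_cons_cons] at hch
    have hb := hl b (by simp)
    exact ih (Pth_step h hc hch.1) hb (fun x hx => hl x (by simp [hx])) hch.2

/-- Every letter of an element of the index set is connected to its head. -/
theorem connected (hs : ∀ a b, θ a b → θ b a) {z : A} (hz : z ∉ B) (wl : List (A ⊕ A))
    (hwl : ∀ x ∈ wl, unbar x ∈ B)
    (hIA : IA (tilde θ) (tl (tilde θ) (Sum.inl z :: wl)) = {Sum.inl z}) :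
    ∀ x ∈ wl, Pth θ B z (unbar x) := by
  induction wl using List.reverseRecOn with
  | nil => simp
  | append_singleton wl x ih =>
    have hx : unbar x ∈ B := hwl x (by simp)
    rw [← List.cons_append, tl_append, tl_single] at hIA
    have hcm : ¬ Cm (tilde θ) x (tl (tilde θ) (Sum.inl z :: wl)) := by
      intro hc
      have : x ∈ IA (tilde θ) (tl (tilde θ) (Sum.inl z :: wl) * trOf (tilde θ) x) :=
        ⟨_, Cm_comm hc⟩
      rw [hIA] at this
      have this : x = Sum.inl z := this
      subst this
      exact hz hx
    rw [IA_mul_trOf (tilde_symm hs) hcm] at hIA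
    have ih := ih (fun y hy => hwl y (by simp [hy])) hIA
    intro y hy
    simp only [List.mem_append, List.mem_singleton] at hy
    rcases hy with hy | rfl
    · exact ih y hy
    · simp only [Cm, mem_Alph_tl, not_forall] at hcm
      obtain ⟨c, hc, hyc⟩ := hcm
      rcases List.mem_cons.1 hc with rfl | hc
      · apply Pth_single
        refine ⟨fun e => hz ?_, fun h => hyc (hs _ _ h)⟩
        rw [e]; exact hx
      · by_cases e : unbar c = unbar y
        · rw [← e]; exact ih c hc
        · exact Pth_step (ih c hc) (hwl c (by simp [hc])) ⟨e, fun h => hyc (hs _ _ h)⟩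

theorem indep_of_TFSA (hs : ∀ a b, θ a b → θ b a) (hT : IsTFSA θ B) {z z' : A} (hz : z ∉ B)
    (hz' : z' ∉ B) (hzz : θ z z') (wl wl' : List (A ⊕ A))
    (hwl : ∀ x ∈ wl, unbar x ∈ B) (hwl' : ∀ x ∈ wl', unbar x ∈ B)
    (hIA : IA (tilde θ) (tl (tilde θ) (Sum.inl z :: wl)) = {Sum.inl z})
    (hIA' : IA (tilde θ) (tl (tilde θ) (Sum.inl z' :: wl')) = {Sum.inl z'}) :
    ∀ a ∈ Alph (tilde θ) (tl (tilde θ) (Sum.inl z :: wl)),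
      ∀ b ∈ Alph (tilde θ) (tl (tilde θ) (Sum.inl z' :: wl')), tilde θ a b := by
  intro a ha b hb
  rw [mem_Alph_tl, List.mem_cons] at ha hb
  have hno := hT z z' hz hz' hzz
  rw [Pth_iff] at hno
  by_contra hab
  change ¬ θ (unbar a) (unbar b) at hab
  rcases ha with rfl | ha <;> rcases hb with rfl | hb
  · exact hab hzz
  · have hP := connected hs hz' wl' hwl' hIA' b hb
    have hB := hwl' b hb
    refine hno (Pth_trans (Pth_single ⟨?_, hab⟩) hB (Pth_symm hs hP))
    intro e; apply hz; change z = unbar b at e; rw [e]; exact hB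
  · have hP := connected hs hz wl hwl hIA a ha
    have hB := hwl a ha
    refine hno (Pth_step hP hB ⟨?_, hab⟩)
    intro e; apply hz'; change unbar a = z' at e; rw [← e]; exact hB
  · have hP' := connected hs hz' wl' hwl' hIA' b hb
    have hB' := hwl' b hb
    have hP := connected hs hz wl hwl hIA a ha
    have hB := hwl a ha
    by_cases e : unbar a = unbar b
    · rw [e] at hP
      exact hno (Pth_trans hP hB' (Pth_symm hs hP'))
    · exact hno (Pth_trans (Pth_step hP hB ⟨e, hab⟩) hB' (Pth_symm hs hP'))

end Paths

section Main

variable {A : Type*} {θ : A → A → Prop} {B : Set A}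

/-- Independence of index elements through their heads. -/
def RX (θ : A → A → Prop) (B : Set A) (t t' : XS θ B) : Prop :=
  ∃ a ∈ IA (tilde θ) (t : Trace (A ⊕ A) (tilde θ)),
    ∃ b ∈ IA (tilde θ) (t' : Trace (A ⊕ A) (tilde θ)), tilde θ a b

/-- Permutation of the index set by a letter. -/
noncomputable def EP (hi : ∀ a, ¬ θ a a) (hs : ∀ a b, θ a b → θ b a) (x : A ⊕ A)
    (hx : unbar x ∈ B) : Equiv.Perm (XS θ B) where
  toFun t := ⟨act θ x t, (act_spec hi hs hx t.2).1⟩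
  invFun t := ⟨act θ x.swap t, (act_spec hi hs (by rwa [unbar_swap]) t.2).1⟩
  left_inv t := Subtype.ext (act_spec hi hs hx t.2).2.2
  right_inv t := Subtype.ext (by
    have := (act_spec hi hs (x := x.swap) (by rwa [unbar_swap]) t.2).2.2
    rwa [Sum.swap_swap] at this)

/-- Automorphism attached to a letter. -/
noncomputable def SA (hi : ∀ a, ¬ θ a a) (hs : ∀ a b, θ a b → θ b a) (x : A ⊕ A)
    (hx : unbar x ∈ B) : MulAut (PCGroup (XS θ B) (RX θ B)) :=
  pcAut (EP hi hs x hx)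
    (by
      rintro t t' h
      simp only [RX, EP, Equiv.coe_fn_mk] at h ⊢
      rwa [(act_spec hi hs hx t.2).2.1, (act_spec hi hs hx t'.2).2.1])
    (by
      rintro t t' h
      have hx' : unbar x.swap ∈ B := by rwa [unbar_swap]
      simp only [RX, EP, Equiv.coe_fn_symm_mk] at h ⊢
      rwa [(act_spec hi hs hx' t.2).2.1, (act_spec hi hs hx' t'.2).2.1])

theorem SA_of (hi : ∀ a, ¬ θ a a) (hs : ∀ a b, θ a b → θ b a) (x : A ⊕ A)
    (hx : unbar x ∈ B) (t : XS θ B) :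
    SA hi hs x hx (gOf _ t) = gOf _ ⟨act θ x t, (act_spec hi hs hx t.2).1⟩ := pcAut_of _ _ _ t

theorem SA_inv (hi : ∀ a, ¬ θ a a) (hs : ∀ a b, θ a b → θ b a) (x : A ⊕ A)
    (hx : unbar x ∈ B) (hx' : unbar x.swap ∈ B) :
    (SA hi hs x hx)⁻¹ = SA hi hs x.swap hx' := by
  rw [inv_eq_iff_mul_eq_one]
  apply mulAut_ext
  intro t
  rw [MulAut.mul_apply, SA_of, SA_of, MulAut.one_apply]
  congr 1
  apply Subtype.ext
  have := (act_spec hi hs hx' t.2).2.2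
  rwa [Sum.swap_swap] at this

theorem inr_mem {a : A} (h : a ∈ B) : unbar (Sum.inr a) ∈ B := h

open Classical in
/-- Images of the letters in the semidirect product. -/
noncomputable def phi (hi : ∀ a, ¬ θ a a) (hs : ∀ a b, θ a b → θ b a) (B : Set A) (a : A) :
    PCGroup (XS θ B) (RX θ B) ⋊[MonoidHom.id _] MulAut (PCGroup (XS θ B) (RX θ B)) :=
  if h : a ∈ B then SemidirectProduct.inr (SA hi hs (Sum.inr a) (inr_mem h))
  else SemidirectProduct.inl (gOf _ ⟨trOf (tilde θ) (Sum.inl a), XS_trOf hs h⟩)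

theorem phi_mixed (hi : ∀ a, ¬ θ a a) (hs : ∀ a b, θ a b → θ b a) {a b : A} (ha : a ∉ B)
    (hb : b ∈ B) (h : θ a b) : phi hi hs B b * phi hi hs B a = phi hi hs B a * phi hi hs B b := by
  rw [phi, dif_pos hb, phi, dif_neg ha]
  rw [← mul_inv_eq_iff_eq_mul, ← map_inv, ← SemidirectProduct.inl_aut]
  congr 1
  change SA hi hs (Sum.inr b) (inr_mem hb) _ = _
  rw [SA_of]
  congr 1
  apply Subtype.ext
  exact act_cm hi (Cm_trOf.2 (hs _ _ h))

theorem phi_comm (hi : ∀ a, ¬ θ a a) (hs : ∀ a b, θ a b → θ b a) (a b : A) (h : θ a b) :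
    phi hi hs B a * phi hi hs B b = phi hi hs B b * phi hi hs B a := by
  by_cases ha : a ∈ B <;> by_cases hb : b ∈ B
  · rw [phi, dif_pos ha, phi, dif_pos hb, ← map_mul, ← map_mul]
    congr 1
    apply mulAut_ext
    intro t
    rw [MulAut.mul_apply, MulAut.mul_apply, SA_of, SA_of, SA_of, SA_of]
    congr 1
    apply Subtype.ext
    exact act_comm hi hs (x := Sum.inr a) (y := Sum.inr b) h t
  · exact phi_mixed hi hs hb ha (hs _ _ h)
  · exact (phi_mixed hi hs ha hb h).symm
  · rw [phi, dif_neg ha, phi, dif_neg hb, ← map_mul, ← map_mul]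
    congr 1
    apply gOf_comm
    exact ⟨Sum.inl a, ⟨1, by rw [mul_one]⟩, Sum.inl b, ⟨1, by rw [mul_one]⟩, h⟩

/-- The morphism to the semidirect product. -/
noncomputable def Phi (hi : ∀ a, ¬ θ a a) (hs : ∀ a b, θ a b → θ b a) (B : Set A) :
    PCGroup A θ →*
      PCGroup (XS θ B) (RX θ B) ⋊[MonoidHom.id _] MulAut (PCGroup (XS θ B) (RX θ B)) :=
  pcLift (phi hi hs B) (phi_comm hi hs)

variable {s : Trace (A ⊕ A) (tilde θ) →* PCGroup A θ}

theorem Phi_letter (hi : ∀ a, ¬ θ a a) (hs : ∀ a b, θ a b → θ b a) (hsec : IsSection θ s)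
    (x : A ⊕ A) (hx : unbar x ∈ B) :
    Phi hi hs B (s (trOf (tilde θ) x)) = SemidirectProduct.inr (SA hi hs x hx)⁻¹ := by
  rcases x with a | a
  · have ha : a ∈ B := hx
    rw [hsec.1, Phi, pcLift_of, phi, dif_pos ha, SA_inv hi hs _ hx (inr_mem ha)]
    rfl
  · have ha : a ∈ B := hx
    rw [hsec.2, map_inv, Phi, pcLift_of, phi, dif_pos ha, map_inv]

theorem Phi_conj (hi : ∀ a, ¬ θ a a) (hs : ∀ a b, θ a b → θ b a) (hsec : IsSection θ s)
    {z : A} (hz : z ∉ B) (wl : List (A ⊕ A)) (hwl : ∀ x ∈ wl, unbar x ∈ B)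
    (ht : tl (tilde θ) (Sum.inl z :: wl) ∈ XS θ B) :
    Phi hi hs B ((s (tl (tilde θ) wl))⁻¹ * gOf θ z * s (tl (tilde θ) wl)) =
      SemidirectProduct.inl (gOf _ ⟨_, ht⟩) := by
  induction wl using List.reverseRecOn with
  | nil =>
    simp only [tl_nil, map_one, inv_one, one_mul, mul_one]
    rw [Phi, pcLift_of, phi, dif_neg hz]
    rfl
  | append_singleton wl x ih =>
    have hx : unbar x ∈ B := hwl x (by simp)
    have e : tl (tilde θ) (Sum.inl z :: (wl ++ [x])) =
        tl (tilde θ) (Sum.inl z :: wl) * trOf (tilde θ) x := by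
      rw [← List.cons_append, tl_append, tl_single]
    have ht' := ht
    rw [e] at ht'
    obtain ⟨h1, h2, h3, h4⟩ := XS_strip hi hs hx ht'
    have ih := ih (fun y hy => hwl y (by simp [hy])) h1
    have e2 : (s (tl (tilde θ) (wl ++ [x])))⁻¹ * gOf θ z * s (tl (tilde θ) (wl ++ [x])) =
        (s (trOf (tilde θ) x))⁻¹ *
          ((s (tl (tilde θ) wl))⁻¹ * gOf θ z * s (tl (tilde θ) wl)) * s (trOf (tilde θ) x) := by
      rw [tl_append, tl_single, map_mul]; group
    rw [e2, map_mul, map_mul, ih, map_inv, Phi_letter hi hs hsec x hx, ← map_inv, inv_inv,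
      ← SemidirectProduct.inl_aut]
    congr 1
    change SA hi hs x hx _ = _
    rw [SA_of]
    congr 1
    apply Subtype.ext
    change act θ x _ = tl (tilde θ) _
    rw [act_app h3 h2, e]

theorem s_swap (hsec : IsSection θ s) (x : A ⊕ A) :
    s (trOf (tilde θ) x) * s (trOf (tilde θ) x.swap) = 1 := by
  rcases x with a | a
  · rw [Sum.swap_inl, hsec.1, hsec.2, mul_inv_cancel]
  · rw [Sum.swap_inr, hsec.1, hsec.2, inv_mul_cancel]

theorem Irr_of_reduced (hsec : IsSection θ s) {t : Trace (A ⊕ A) (tilde θ)}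
    (h : ReducedWrt θ s t) : Irr θ t := by
  intro p x q e
  obtain ⟨l, rfl⟩ := tl_surj p
  obtain ⟨l', rfl⟩ := tl_surj q
  have := h (tl _ l * tl _ l') (l ++ [x] ++ [x.swap] ++ l').length (l ++ l').length
    (by rw [e, map_mul, map_mul, map_mul, map_mul, mul_assoc (s (tl _ l)), s_swap hsec, mul_one])
    ⟨_, by rw [e, ← tl_single, ← tl_single, ← tl_append, ← tl_append, ← tl_append]; rfl, rfl⟩
    ⟨_, by rw [← tl_append]; rfl, rfl⟩
  simp at this

theorem betaR_sub (hsec : IsSection θ s) {t : Trace (A ⊕ A) (tilde θ)}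
    (ht : t ∈ betaR θ B s) : t ∈ XS θ B := by
  obtain ⟨z, hz, wl, hwl, e, hIA, hr⟩ := ht
  refine ⟨z, hz, tl _ wl, ?_, ?_, hIA, Irr_of_reduced hsec hr⟩
  · intro c hc
    rw [mem_Alph_tl] at hc
    exact hwl c hc
  · rw [← tl_cons]; exact e

/-- The relation of the statement. -/
def RB (θ : A → A → Prop) (B : Set A) (s : Trace (A ⊕ A) (tilde θ) →* PCGroup A θ)
    (x y : betaR θ B s) : Prop :=
  ∀ a ∈ Alph (tilde θ) (x : Trace (A ⊕ A) (tilde θ)),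
          ∀ b ∈ Alph (tilde θ) (y : Trace (A ⊕ A) (tilde θ)), tilde θ a b

theorem RX_of_RB (hsec : IsSection θ s) {t t' : betaR θ B s} (h : RB θ B s t t') :
    RX θ B ⟨t, betaR_sub hsec t.2⟩ ⟨t', betaR_sub hsec t'.2⟩ := by
  obtain ⟨z, hz, wl, hwl, e, hIA, hr⟩ := t.2
  obtain ⟨z', hz', wl', hwl', e', hIA', hr'⟩ := t'.2
  have h1 : Sum.inl z ∈ IA (tilde θ) (t : Trace (A ⊕ A) (tilde θ)) := by rw [hIA]; rfl
  have h2 : Sum.inl z' ∈ IA (tilde θ) (t' : Trace (A ⊕ A) (tilde θ)) := by rw [hIA']; rfl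
  exact ⟨_, h1, _, h2, h _ (IA_sub_Alph _ h1) _ (IA_sub_Alph _ h2)⟩

theorem RB_of_RX (hs : ∀ a b, θ a b → θ b a) (hT : IsTFSA θ B) {t t' : XS θ B}
    (h : RX θ B t t') (ht : t.1 ∈ betaR θ B s) (ht' : t'.1 ∈ betaR θ B s) :
    RB θ B s ⟨t.1, ht⟩ ⟨t'.1, ht'⟩ := by
  obtain ⟨a, ha, b, hb, hab⟩ := h
  obtain ⟨z, hz, wl, hwl, e, hIA, hr⟩ := ht
  obtain ⟨z', hz', wl', hwl', e', hIA', hr'⟩ := ht'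
  rw [hIA] at ha
  rw [hIA'] at hb
  obtain rfl : a = Sum.inl z := ha
  obtain rfl : b = Sum.inl z' := hb
  have := indep_of_TFSA hs hT hz hz' hab wl wl' hwl hwl' (by rw [e] at hIA; exact hIA)
    (by rw [e'] at hIA'; exact hIA')
  intro a ha b hb
  apply this
  · rw [e] at ha; exact ha
  · rw [e'] at hb; exact hb

theorem inj_of_TFSA (hi : ∀ a, ¬ θ a a) (hs : ∀ a b, θ a b → θ b a) (hsec : IsSection θ s)
    (hT : IsTFSA θ B) (α : PCGroup (betaR θ B s) (RB θ B s) →* PCGroup A θ)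
    (hα : ∀ (z : A) (wl : List (A ⊕ A)), z ∉ B → (∀ x ∈ wl, unbar x ∈ B) →
      ∀ ht : tl (tilde θ) (Sum.inl z :: wl) ∈ betaR θ B s,
        α (gOf _ ⟨_, ht⟩) =
          (s (tl (tilde θ) wl))⁻¹ * gOf θ z * s (tl (tilde θ) wl)) :
    Function.Injective α := by
  classical
  let ι : PCGroup (betaR θ B s) (RB θ B s) →* PCGroup (XS θ B) (RX θ B) :=
    pcLift (fun t => gOf _ ⟨t, betaR_sub hsec t.2⟩) (fun a b h => gOf_comm (RX_of_RB hsec h))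
  let ψ : PCGroup (XS θ B) (RX θ B) →* PCGroup (betaR θ B s) (RB θ B s) :=
    pcLift (fun t => if h : t.1 ∈ betaR θ B s then gOf _ ⟨t.1, h⟩ else 1) (by
      intro a b h
      by_cases ha : a.1 ∈ betaR θ B s <;> by_cases hb : b.1 ∈ betaR θ B s
      · rw [dif_pos ha, dif_pos hb]
        exact gOf_comm (RB_of_RX hs hT h ha hb)
      · rw [dif_neg hb, one_mul, mul_one]
      · rw [dif_neg ha, one_mul, mul_one]
      · rw [dif_neg hb, one_mul, mul_one])
  have h1 : ψ.comp ι = MonoidHom.id _ := by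
    apply pc_ext
    intro t
    simp only [MonoidHom.comp_apply, ι, ψ, pcLift_of, MonoidHom.id_apply]
    rw [dif_pos t.2]
  have h2 : (Phi hi hs B).comp α = SemidirectProduct.inl.comp ι := by
    apply pc_ext
    rintro ⟨t, ht⟩
    obtain ⟨z, hz, wl, hwl, e, hIA, hr⟩ := id ht
    have e : t = tl (tilde θ) (Sum.inl z :: wl) := e
    subst e
    rw [MonoidHom.comp_apply, hα z wl hz hwl, Phi_conj hi hs hsec hz wl hwl (betaR_sub hsec ht),
      MonoidHom.comp_apply]
    simp only [ι, pcLift_of]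
  have h3 : Function.Injective ι :=
    Function.LeftInverse.injective (g := ψ) (fun x => DFunLike.congr_fun h1 x)
  have h4 : Function.Injective ((Phi hi hs B).comp α) := by
    rw [h2]
    exact SemidirectProduct.inl_injective.comp h3
  exact Function.Injective.of_comp (f := Phi hi hs B) (by simpa using h4)

/-- Total exponent. -/
def deg (θ : A → A → Prop) : PCGroup A θ →* Multiplicative ℤ :=
  pcLift (fun _ => Multiplicative.ofAdd 1) (fun _ _ _ => rfl)

theorem deg_le (hsec : IsSection θ s) (l : List (A ⊕ A)) :
    (deg θ (s (tl _ l))).toAdd ≤ l.length := by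
  induction l with
  | nil => simp [tl_nil]
  | cons x l ih =>
    rw [tl_cons, map_mul, map_mul, toAdd_mul]
    have : (deg θ (s (trOf _ x))).toAdd ≤ 1 := by
      rcases x with a | a
      · rw [hsec.1, deg, pcLift_of]; simp
      · rw [hsec.2, map_inv, deg, pcLift_of]; simp
    simp only [List.length_cons]
    push_cast
    linarith

theorem deg_pos (hsec : IsSection θ s) (l : List A) :
    (deg θ (s (tl _ (l.map Sum.inl)))).toAdd = l.length := by
  induction l with
  | nil => simp [tl_nil]
  | cons x l ih =>
    rw [List.map_cons, tl_cons, map_mul, map_mul, toAdd_mul, ih, hsec.1, deg, pcLift_of]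
    simp [add_comm]

theorem reduced_pos (hsec : IsSection θ s) (l : List A) :
    ReducedWrt θ s (tl _ (l.map Sum.inl)) := by
  rintro t' n n' h ⟨l1, h1, rfl⟩ ⟨l2, h2, rfl⟩
  have e1 := (tl_perm (ϑ := tilde θ) h1).length_eq
  have e2 := deg_le hsec l2
  change tl _ l2 = t' at h2
  rw [h2, h, deg_pos hsec] at e2
  rw [e1, List.length_map]
  exact_mod_cast e2

theorem IA_chain (hs : ∀ a b, θ a b → θ b a) (z : A) (l : List A)
    (h : List.IsChain (dep θ) (z :: l)) :
    IA (tilde θ) (tl (tilde θ) ((z :: l).map Sum.inl)) = {Sum.inl z} := by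
  ext c
  rw [mem_IA_tl (tilde_symm hs), Set.mem_singleton_iff]
  constructor
  · induction l generalizing z with
    | nil => simp [Init]
    | cons b l ih =>
      rw [List.isChain_cons_cons] at h
      rintro (h1 | ⟨h1, h2⟩)
      · exact h1
      · have := ih b h.2 h2
        subst this
        exact (h.1.2 (hs _ _ h1)).elim
  · rintro rfl
    exact Or.inl rfl

theorem betaR_chain (hs : ∀ a b, θ a b → θ b a) (hsec : IsSection θ s) {z : A} (hz : z ∉ B)
    {l : List A} (hl : ∀ b ∈ l, b ∈ B) (h : List.IsChain (dep θ) (z :: l)) :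
    tl (tilde θ) (Sum.inl z :: l.map Sum.inl) ∈ betaR θ B s := by
  refine ⟨z, hz, l.map Sum.inl, ?_, rfl, IA_chain hs z l h, reduced_pos hsec (z :: l)⟩
  intro x hx
  obtain ⟨b, hb, rfl⟩ := List.mem_map.1 hx
  exact hl b hb

theorem first_dep {z' : A} (hz' : z' ∉ B) (l : List A) (z : A) (hzz : ¬ dep θ z z')
    (hl : ∀ b ∈ l, b ∈ B)
    (h : List.IsChain (dep θ) (z :: (l ++ [z']))) :
    ∃ (p : List A) (b : A), (∀ c ∈ p, c ∈ B) ∧ b ∈ B ∧ (∀ c ∈ p, θ c z') ∧ dep θ b z' ∧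
      List.IsChain (dep θ) (z :: (p ++ [b])) := by
  induction l generalizing z with
  | nil => simp at h; exact (hzz h).elim
  | cons b l ih =>
    rw [List.cons_append, List.isChain_cons_cons] at h
    have hb := hl b (by simp)
    by_cases hd : dep θ b z'
    · exact ⟨[], b, by simp, hb, by simp, hd, by simpa using h.1⟩
    · obtain ⟨p, c, h1, h2, h3, h4, h5⟩ := ih b hd (fun x hx => hl x (by simp [hx])) h.2
      refine ⟨b :: p, c, ?_, h2, ?_, h4, ?_⟩
      · simpa using ⟨hb, h1⟩
      · have : θ b z' := by
          by_contra hn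
          exact hd ⟨fun e => hz' (e ▸ hb), hn⟩
        simpa using ⟨this, h3⟩
      · rw [List.cons_append, List.isChain_cons_cons]
        exact ⟨h.1, h5⟩

theorem s_commute (hsec : IsSection θ s) {z : A} (p : List A) (h : ∀ c ∈ p, θ c z) :
    Commute (s (tl (tilde θ) (p.map Sum.inl))) (gOf θ z) := by
  induction p with
  | nil => simp [tl_nil]
  | cons c p ih =>
    rw [List.map_cons, tl_cons, map_mul, hsec.1]
    exact Commute.mul_left (gOf_comm (h c (by simp))) (ih fun d hd => h d (by simp [hd]))

theorem TFSA_of_inj (hi : ∀ a, ¬ θ a a) (hs : ∀ a b, θ a b → θ b a) (hsec : IsSection θ s)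
    (α : PCGroup (betaR θ B s) (RB θ B s) →* PCGroup A θ)
    (hα : ∀ (z : A) (wl : List (A ⊕ A)), z ∉ B → (∀ x ∈ wl, unbar x ∈ B) →
      ∀ ht : tl (tilde θ) (Sum.inl z :: wl) ∈ betaR θ B s,
        α (gOf _ ⟨_, ht⟩) =
          (s (tl (tilde θ) wl))⁻¹ * gOf θ z * s (tl (tilde θ) wl))
    (hinj : Function.Injective α) : IsTFSA θ B := by
  intro z z' hz hz' hzz hP
  rw [Pth_iff] at hP
  obtain ⟨l, hl, hch⟩ := hP
  obtain ⟨p, b, hp, hb, hpz, hbz, hch2⟩ := first_dep hz' l z (fun h => h.2 hzz) hl hch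
  have hpb : ∀ c ∈ p ++ [b], c ∈ B := by
    intro c hc
    simp only [List.mem_append, List.mem_singleton] at hc
    rcases hc with hc | rfl
    exacts [hp c hc, hb]
  have hb1 : ∀ c ∈ [b], c ∈ B := by simpa using hb
  have hx := betaR_chain hs hsec hz hpb hch2
  have hy := betaR_chain (s := s) hs hsec hz' (l := [b]) hb1 (by simpa using dep_symm hs hbz)
  have hun : ∀ l : List A, (∀ c ∈ l, c ∈ B) → ∀ x ∈ l.map (Sum.inl : A → A ⊕ A), unbar x ∈ B := by
    intro l hl x hx
    obtain ⟨b, hb, rfl⟩ := List.mem_map.1 hx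
    exact hl b hb
  have ax := hα z _ hz (hun _ hpb) hx
  have ay := hα z' _ hz' (hun _ hb1) hy
  have bx : Sum.inl b ∈ Alph (tilde θ) (tl (tilde θ) (Sum.inl z :: (p ++ [b]).map Sum.inl)) := by
    rw [mem_Alph_tl]; simp
  have bY : Sum.inl b ∈ Alph (tilde θ) (tl (tilde θ) (Sum.inl z' :: [b].map Sum.inl)) := by
    rw [mem_Alph_tl]; simp
  refine not_comm_of (R := RB θ B s) (x := ⟨_, hx⟩) (y := ⟨_, hy⟩) ?_ ?_ ?_ (hinj ?_)
  · intro e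
    have e := congrArg Subtype.val e
    have hm : (Sum.inl z' : A ⊕ A) ∈
        Alph (tilde θ) (tl (tilde θ) (Sum.inl z :: (p ++ [b]).map Sum.inl)) := by
      rw [show tl (tilde θ) (Sum.inl z :: (p ++ [b]).map Sum.inl) = _ from e, mem_Alph_tl]
      simp
    rw [mem_Alph_tl, List.mem_cons] at hm
    rcases hm with hm | hm
    · have := Sum.inl_injective hm
      exact hi z (by rw [← this] at hzz ⊢; exact hzz)
    · exact hz' (hun _ hpb _ hm)
  · intro h; exact hi b (h _ bx _ bY)
  · intro h; exact hi b (h _ bY _ bx)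
  · rw [map_mul, map_mul, ax, ay]
    have hc := s_commute hsec p hpz
    have e3 : (s (tl (tilde θ) ([b].map Sum.inl)))⁻¹ * gOf θ z' *
        s (tl (tilde θ) ([b].map Sum.inl)) =
        (s (tl (tilde θ) ((p ++ [b]).map Sum.inl)))⁻¹ * gOf θ z' *
        s (tl (tilde θ) ((p ++ [b]).map Sum.inl)) := by
      rw [List.map_append, tl_append, map_mul, mul_inv_rev]
      simp only [mul_assoc]
      rw [← mul_assoc (gOf θ z'), ← hc.eq]
      group
    rw [e3]
    have hzc := gOf_comm hzz
    generalize s (tl (tilde θ) ((p ++ [b]).map Sum.inl)) = w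
    have h1 : w⁻¹ * gOf θ z * w * (w⁻¹ * gOf θ z' * w) = w⁻¹ * (gOf θ z * gOf θ z') * w := by group
    have h2 : w⁻¹ * gOf θ z' * w * (w⁻¹ * gOf θ z * w) = w⁻¹ * (gOf θ z' * gOf θ z) * w := by group
    rw [h1, h2, hzc]

end Main

end PCM

open PCM in
/-- the natural morphism `α : F(β_Z^R(B̃), θ̃_{β_Z^R(B̃)}) → H_Z`,
`zw ↦ w⁻¹zw`, is injective iff `B` is a transitively factorizing subalphabet. -/
theorem stmt_15 {A : Type*} (θ : A → A → Prop)
    (hanti : ∀ a, ¬ θ a a) (hsymm : ∀ a b, θ a b → θ b a) (B : Set A)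
    (s : Trace (A ⊕ A) (tilde θ) →* PCGroup A θ) (hs : IsSection θ s)
    (α : PCGroup (betaR θ B s)
        (fun x y => ∀ a ∈ Alph (tilde θ) (x : Trace (A ⊕ A) (tilde θ)),
          ∀ b ∈ Alph (tilde θ) (y : Trace (A ⊕ A) (tilde θ)), tilde θ a b) →*
      PCGroup A θ)
    (hα : ∀ (z : A) (wl : List (A ⊕ A)), z ∉ B → (∀ x ∈ wl, unbar x ∈ B) →
      ∀ ht : trMk (tilde θ) (FreeMonoid.ofList (Sum.inl z :: wl)) ∈ betaR θ B s,
        α (gOf _ ⟨_, ht⟩) =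
          (s (trMk (tilde θ) (FreeMonoid.ofList wl)))⁻¹ * gOf θ z *
            s (trMk (tilde θ) (FreeMonoid.ofList wl))) :
    Function.Injective α ↔ IsTFSA θ B := by
  exact ⟨TFSA_of_inj hanti hsymm hs α hα, fun hT => inj_of_TFSA hanti hsymm hs hT α hα⟩
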